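/- arXiv:0904.1023 — 6 statements merged into one kernel-verified Lean document; each statement's English description precedes it below -/
import Mathlib

section
/- For any unital associative algebra A over a commutative ring k, the maps ∂₁ and ∂₂ of the partial complex satisfy ∂₁ ∘ ∂₂ = 0; that is, 0 ← A ←∂₁− A⊗A⊗A ←∂₂− (A⊗A⊗A⊗A) ⊕ A is a chain complex. -/
open TensorProduct

/-- For any unital associative algebra `A` over a commutative ring `k`, the maps
`∂₁(a⊗b⊗c) = abc − cba` and `∂₂(a⊗b⊗c⊗d) = ab⊗c⊗d + d⊗ca⊗b + bca⊗1⊗d + d⊗bc⊗a`,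
`∂₂(a) = 1⊗a⊗1` satisfy `∂₁ ∘ ∂₂ = 0`, i.e.
`0 ← A ← A⊗A⊗A ← (A⊗A⊗A⊗A) ⊕ A` is a chain complex. -/
theorem partialComplex_d1_comp_d2_eq_zero
    (k : Type u) [CommRing k] (A : Type v) [Ring A] [Algebra k A]
    (d₁ : A ⊗[k] (A ⊗[k] A) →ₗ[k] A)
    (d₂ : ((A ⊗[k] (A ⊗[k] (A ⊗[k] A))) × A) →ₗ[k] A ⊗[k] (A ⊗[k] A))
    (h₁ : ∀ a b c : A, d₁ (a ⊗ₜ[k] (b ⊗ₜ[k] c)) = a * b * c - c * b * a)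
    (h₂ : ∀ a b c d : A, d₂ (a ⊗ₜ[k] (b ⊗ₜ[k] (c ⊗ₜ[k] d)), 0) =
      (a * b) ⊗ₜ[k] (c ⊗ₜ[k] d) + d ⊗ₜ[k] ((c * a) ⊗ₜ[k] b) +
        (b * c * a) ⊗ₜ[k] ((1 : A) ⊗ₜ[k] d) + d ⊗ₜ[k] ((b * c) ⊗ₜ[k] a))
    (h₃ : ∀ a : A, d₂ (0, a) = (1 : A) ⊗ₜ[k] (a ⊗ₜ[k] (1 : A))) :
    d₁ ∘ₗ d₂ = 0 := by
  apply LinearMap.prod_ext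
  · ext a b c d
    simp [h₁, h₂, mul_assoc]
  · ext a
    simp [h₁, h₃]
end

section
/- For a unital associative algebra A over a commutative ring k, the image of ∂₁ : A⊗A⊗A → A, i.e., the k-submodule of A spanned by all elements abc − cba with a, b, c ∈ A, equals the two-sided ideal of A generated by all commutators xy − yx; consequently H₀ of the partial complex, namely A / im ∂₁, is A/([A,A]), which is HS₀(A). -/
open TensorProduct

/-- The image of `∂₁ : A⊗A⊗A → A`, `∂₁(a⊗b⊗c) = abc − cba`, i.e. the `k`-submodule
of `A` spanned by all elements `abc − cba`, equals the two-sided ideal of `A`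
generated by all commutators `xy − yx`; consequently `H₀` of the partial complex,
namely `A / im ∂₁`, is `A/([A,A])`, which is `HS₀(A)`. -/
theorem range_d1_eq_commutator_ideal
    (k : Type u) [CommRing k] (A : Type v) [Ring A] [Algebra k A]
    (d₁ : A ⊗[k] (A ⊗[k] A) →ₗ[k] A)
    (h₁ : ∀ a b c : A, d₁ (a ⊗ₜ[k] (b ⊗ₜ[k] c)) = a * b * c - c * b * a) :
    (LinearMap.range d₁ : Set A) =
      (TwoSidedIdeal.span {x : A | ∃ y z : A, x = y * z - z * y} : Set A) := by
  apply Set.Subset.antisymm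
  · rintro _ ⟨t, rfl⟩
    have comm_mem (x y : A) :
        x * y - y * x ∈ TwoSidedIdeal.span {x : A | ∃ y z : A, x = y * z - z * y} :=
      TwoSidedIdeal.subset_span ⟨x, y, rfl⟩
    induction t with
    | zero => rw [map_zero]; exact zero_mem _
    | add s t hs ht => rw [map_add]; exact add_mem hs ht
    | tmul a s =>
      induction s with
      | zero => rw [TensorProduct.tmul_zero, map_zero]; exact zero_mem _
      | add s t hs ht => rw [TensorProduct.tmul_add, map_add]; exact add_mem hs ht
      | tmul b c =>
        have h : d₁ (a ⊗ₜ[k] (b ⊗ₜ[k] c)) =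
            (a * b - b * a) * c + b * (a * c - c * a) + (b * c - c * b) * a := by
          rw [h₁]; noncomm_ring
        rw [h]
        exact add_mem (add_mem (TwoSidedIdeal.mul_mem_right _ _ _ (comm_mem a b))
          (TwoSidedIdeal.mul_mem_left _ _ _ (comm_mem a c)))
          (TwoSidedIdeal.mul_mem_right _ _ _ (comm_mem b c))
  · intro z hz
    rw [SetLike.mem_coe, TwoSidedIdeal.mem_span_iff_mem_addSubgroup_closure] at hz
    change z ∈ (LinearMap.range d₁).toAddSubgroup
    refine (AddSubgroup.closure_le _).mpr ?_ hz
    rintro _ ⟨_, ⟨a, -, _, ⟨x, y, rfl⟩, rfl⟩, b, -, rfl⟩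
    -- `axyb ~ baxy ~ yxba ~ ayxb` modulo the image of `d₁`
    refine ⟨(a * x * y) ⊗ₜ[k] (1 ⊗ₜ[k] b) + (b * a) ⊗ₜ[k] (x ⊗ₜ[k] y)
      + (y * x * b) ⊗ₜ[k] (1 ⊗ₜ[k] a), ?_⟩
    simp only [map_add, h₁]
    noncomm_ring
end

section
/- Let A be a unital associative algebra over a commutative ring k, and let a, x, y, z ∈ A with xyz = zyx. Then the difference between the left-action and right-action expressions, (ax⊗y⊗z − x⊗ya⊗z + x⊗y⊗az) − (xa⊗y⊗z − x⊗ay⊗z + x⊗y⊗za), lies in the image of ∂₂; that is, the left and right HS₀(A)-actions on HS₁(A) agree. -/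
open TensorProduct

section HomologyRelations

variable {A M : Type*} [Monoid A] [AddCommGroup M] {T : A → A → A → M}

theorem apply_one_one_eq_zero
    (h : ∀ a b c d, T (a * b) c d + T d (c * a) b + T (b * c * a) 1 d + T d (b * c) a = 0)
    (h1 : ∀ a, T 1 a 1 = 0) (a : A) : T a 1 1 = 0 := by
  simpa [h1] using h 1 1 a 1

theorem one_apply_eq
    (h : ∀ a b c d, T (a * b) c d + T d (c * a) b + T (b * c * a) 1 d + T d (b * c) a = 0)
    (h1 : ∀ a, T 1 a 1 = 0) (a b : A) : T 1 a b = -T b a 1 := by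
  have := h b 1 a 1
  simp only [mul_one, one_mul, h1, apply_one_one_eq_zero h h1, add_zero] at this
  exact eq_neg_of_add_eq_zero_right this

theorem apply_one_skew
    (h : ∀ a b c d, T (a * b) c d + T d (c * a) b + T (b * c * a) 1 d + T d (b * c) a = 0)
    (h1 : ∀ a, T 1 a 1 = 0) (a b : A) : T a b 1 + T b a 1 = 0 := by
  have := h a b 1 1
  simp only [mul_one, one_mul, one_apply_eq h h1, apply_one_one_eq_zero h h1, add_zero,
    zero_add] at this
  rw [← neg_eq_zero, ← this]
  abel

theorem apply_one_middle
    (h : ∀ a b c d, T (a * b) c d + T d (c * a) b + T (b * c * a) 1 d + T d (b * c) a = 0)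
    (h1 : ∀ a, T 1 a 1 = 0) (a b : A) : T a 1 b = T a b 1 := by
  have := h 1 1 a b
  simp only [mul_one, one_mul, one_apply_eq h h1] at this
  rw [← sub_eq_zero]
  linear_combination (norm := module) this - apply_one_skew h h1 a b

theorem apply_one_cyclic
    (h : ∀ a b c d, T (a * b) c d + T d (c * a) b + T (b * c * a) 1 d + T d (b * c) a = 0)
    (h1 : ∀ a, T 1 a 1 = 0) (a b c : A) :
    T (a * b) c 1 + T (c * a) b 1 + T (b * c) a 1 = 0 := by
  have := h a b c 1
  simp only [one_apply_eq h h1, apply_one_one_eq_zero h h1] at this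
  linear_combination (norm := module) this + apply_one_skew h h1 (c * a) b +
    apply_one_skew h h1 (b * c) a

theorem apply_skew_outer
    (h : ∀ a b c d, T (a * b) c d + T d (c * a) b + T (b * c * a) 1 d + T d (b * c) a = 0)
    (h1 : ∀ a, T 1 a 1 = 0) (a b c : A) : T a b c + T c b a = 0 := by
  have := h 1 a b c
  simp only [mul_one, one_mul, apply_one_middle h h1] at this
  linear_combination (norm := module) this - apply_one_skew h h1 (a * b) c

theorem apply_skew_right
    (h : ∀ a b c d, T (a * b) c d + T d (c * a) b + T (b * c * a) 1 d + T d (b * c) a = 0)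
    (h1 : ∀ a, T 1 a 1 = 0) (a b c : A) :
    T a b c + T a c b + T (b * c) a 1 + T (c * b) a 1 = 0 := by
  have := h b c 1 a
  simp only [mul_one, one_mul, apply_one_middle h h1] at this
  linear_combination (norm := module) this

theorem left_sub_right_eq_zero
    (h : ∀ a b c d, T (a * b) c d + T d (c * a) b + T (b * c * a) 1 d + T d (b * c) a = 0)
    (h1 : ∀ a, T 1 a 1 = 0) (a x y z : A) (hcycle : x * y * z = z * y * x) :
    (T (a * x) y z - T x (y * a) z + T x y (a * z)) -
      (T (x * a) y z - T x (a * y) z + T x y (z * a)) = 0 := by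
  have S (a b c d : A) :
      T (a * b) c d + T d (c * a) b + T (b * c * a) d 1 + T d (b * c) a = 0 := by
    rw [← apply_one_middle h h1]
    exact h a b c d
  rw [mul_assoc, mul_assoc] at hcycle
  linear_combination (norm := (simp only [mul_assoc, hcycle]; module))
    apply_skew_outer h h1 x (z * a) y + apply_skew_outer h h1 y (x * z) a +
    apply_skew_outer h h1 z (a * y) x + apply_skew_outer h h1 z (y * x) a +
    apply_skew_right h h1 (a * x) y z + apply_skew_right h h1 x y (a * z) -
    apply_skew_right h h1 x y (z * a) + apply_skew_right h h1 (z * y) a x +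
    apply_one_cyclic h h1 a x (y * z) + apply_one_cyclic h h1 y x (z * a) +
    apply_one_cyclic h h1 z a (y * x) - apply_one_cyclic h h1 (z * y) x a -
    apply_one_skew h h1 (a * x) (z * y) - apply_one_skew h h1 (y * z) (a * x) -
    apply_one_skew h h1 (z * a) (y * x) - S a x z y -
    S x a y z - S z y a x -
    S z y x a

end HomologyRelations

/-- Let `a, x, y, z ∈ A` with `xyz = zyx` (so `x⊗y⊗z` is a cycle for `∂₁`). Then the
difference between the left-action and right-action expressions,
`(ax⊗y⊗z − x⊗ya⊗z + x⊗y⊗az) − (xa⊗y⊗z − x⊗ay⊗z + x⊗y⊗za)`, lies in the image of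
`∂₂`; that is, the left and right `HS₀(A)`-actions on `HS₁(A)` agree. -/
theorem left_action_eq_right_action
    (k : Type u) [CommRing k] (A : Type v) [Ring A] [Algebra k A]
    (d₂ : ((A ⊗[k] (A ⊗[k] (A ⊗[k] A))) × A) →ₗ[k] A ⊗[k] (A ⊗[k] A))
    (h₂ : ∀ a b c d : A, d₂ (a ⊗ₜ[k] (b ⊗ₜ[k] (c ⊗ₜ[k] d)), 0) =
      (a * b) ⊗ₜ[k] (c ⊗ₜ[k] d) + d ⊗ₜ[k] ((c * a) ⊗ₜ[k] b) +
        (b * c * a) ⊗ₜ[k] ((1 : A) ⊗ₜ[k] d) + d ⊗ₜ[k] ((b * c) ⊗ₜ[k] a))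
    (h₃ : ∀ a : A, d₂ (0, a) = (1 : A) ⊗ₜ[k] (a ⊗ₜ[k] (1 : A)))
    (a x y z : A) (hcycle : x * y * z = z * y * x) :
    ((a * x) ⊗ₜ[k] (y ⊗ₜ[k] z) - x ⊗ₜ[k] ((y * a) ⊗ₜ[k] z) + x ⊗ₜ[k] (y ⊗ₜ[k] (a * z))) -
        ((x * a) ⊗ₜ[k] (y ⊗ₜ[k] z) - x ⊗ₜ[k] ((a * y) ⊗ₜ[k] z) + x ⊗ₜ[k] (y ⊗ₜ[k] (z * a))) ∈
      LinearMap.range d₂ := by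
  let q := (LinearMap.range d₂).mkQ
  have h (a b c d : A) : q ((a * b) ⊗ₜ[k] (c ⊗ₜ[k] d)) + q (d ⊗ₜ[k] ((c * a) ⊗ₜ[k] b)) +
      q ((b * c * a) ⊗ₜ[k] ((1 : A) ⊗ₜ[k] d)) + q (d ⊗ₜ[k] ((b * c) ⊗ₜ[k] a)) = 0 := by
    simp only [← map_add, ← h₂]
    exact (Submodule.Quotient.mk_eq_zero _).2 (LinearMap.mem_range_self _ _)
  have h1 (a : A) : q ((1 : A) ⊗ₜ[k] (a ⊗ₜ[k] (1 : A))) = 0 := by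
    rw [← h₃]
    exact (Submodule.Quotient.mk_eq_zero _).2 (LinearMap.mem_range_self _ _)
  rw [← Submodule.Quotient.mk_eq_zero, ← Submodule.mkQ_apply]
  simp only [map_sub, map_add]
  exact left_sub_right_eq_zero (T := fun a b c => q (a ⊗ₜ[k] (b ⊗ₜ[k] c))) h h1 a x y z hcycle
end

section
/- Let A be a unital associative algebra over a commutative ring k. The assignment (a, ω) ↦ L_a(ω) induces a well-defined left module structure on H₁ := ker ∂₁ / im ∂₂ over the ring A/([A,A]): for a ∈ A and a cycle ω ∈ ker ∂₁, L_a(ω) is again a cycle, its class modulo im ∂₂ depends only on the class of a in A/([A,A]) and the class of ω in H₁, and the resulting action [a]·[ω] := [L_a(ω)] satisfies the module axioms (additivity in each variable, [1]·[ω] = [ω], and [a]·([b]·[ω]) = [ab]·[ω]). -/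
open TensorProduct

/-- A function of three variables satisfying the relations imposed on the classes of simple tensors
`a ⊗ b ⊗ c` modulo `im ∂₂`. -/
structure IsTripleSymbol {A M : Type*} [Ring A] [AddCommGroup M] (T : A → A → A → M) : Prop where
  one_one : ∀ a, T 1 a 1 = 0
  rel : ∀ a b c d, T (a * b) c d + T d (c * a) b + T (b * c * a) 1 d + T d (b * c) a = 0

namespace IsTripleSymbol

variable {A M : Type*} [Ring A] [AddCommGroup M] {T : A → A → A → M}

theorem apply_one_one (h : IsTripleSymbol T) (a : A) : T a 1 1 = 0 := by
  linear_combination (norm := (simp only [mul_one, one_mul]; abel))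
    h.rel 1 1 a 1 - (3 : ℤ) • h.one_one a

theorem last_one_add (h : IsTripleSymbol T) (a b : A) : T a b 1 + T 1 b a = 0 := by
  linear_combination (norm := (simp only [mul_one, one_mul]; abel))
    h.rel a 1 b 1 - h.one_one (b * a) - h.apply_one_one (b * a)

theorem last_one_add_mid_one (h : IsTripleSymbol T) (a b : A) : T b a 1 + T a 1 b = 0 := by
  linear_combination (norm := (simp only [mul_one, one_mul]; abel))
    h.rel 1 1 a b - h.last_one_add b a

theorem mid_one_add_swap (h : IsTripleSymbol T) (a b : A) : T a 1 b + T b 1 a = 0 := by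
  linear_combination (norm := (simp only [mul_one, one_mul]; abel))
    h.rel a 1 1 b - h.last_one_add_mid_one a b

theorem add_reverse (h : IsTripleSymbol T) (a b c : A) : T a b c + T c b a = 0 := by
  linear_combination (norm := (simp only [mul_one, one_mul]; abel))
    h.rel 1 a b c - h.last_one_add_mid_one (a * b) c

theorem factor (h : IsTripleSymbol T) (a b c d : A) :
    T (a * b) c d - T b (c * a) d - T a (b * c) d + T (b * c * a) 1 d = 0 := by
  linear_combination (norm := (simp only [mul_assoc]; abel))
    h.rel a b c d - h.add_reverse b (c * a) d - h.add_reverse a (b * c) d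

theorem add_swap_left (h : IsTripleSymbol T) (a b c : A) :
    T a b c + T b a c - T (a * b) 1 c - T (b * a) 1 c = 0 := by
  linear_combination (norm := (simp only [mul_one, one_mul]; abel))
    -h.factor a b 1 c

theorem cyclic (h : IsTripleSymbol T) (a b c : A) :
    T (a * b) 1 c + T (c * a) 1 b + T (b * c) 1 a = 0 := by
  linear_combination (norm := abel)
    h.rel a b c 1 - h.last_one_add_mid_one c (a * b) + h.mid_one_add_swap c (a * b)
      - h.last_one_add b (c * a) + h.last_one_add_mid_one (c * a) b
      - h.last_one_add a (b * c) + h.last_one_add_mid_one (b * c) a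
      - h.apply_one_one (b * c * a)

/-- `L_a` acts compatibly with multiplication. -/
theorem action_mul (h : IsTripleSymbol T) (a b x y z : A) :
    (T (a * (b * x)) y z - T (b * x) (y * a) z + T (b * x) y (a * z))
      - (T (a * x) (y * b) z - T x (y * b * a) z + T x (y * b) (a * z))
      + (T (a * x) y (b * z) - T x (y * a) (b * z) + T x y (a * (b * z)))
      = T (a * b * x) y z - T x (y * (a * b)) z + T x y (a * b * z) := by
  linear_combination (norm := (simp only [mul_assoc]; abel))
    -h.factor b x (y * a) z + h.factor b x y (a * z) - h.factor a x (y * b) z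
      + h.factor a x y (b * z)
      + h.add_reverse b (x * y) (a * z) - h.factor a z (x * y) b
      - h.add_reverse b (x * y * a) z
      + h.add_reverse a (x * y) (b * z) - h.factor b z (x * y) a
      - h.add_reverse a (x * y * b) z
      - h.add_reverse a (z * x * y) b
      + h.cyclic (x * y * b) a z + h.cyclic (x * y * a) b z
      - h.mid_one_add_swap (a * z) (x * y * b) - h.mid_one_add_swap (b * z) (x * y * a)

/-- `L_e` preserves the relations coming from the first summand. -/
theorem action_rel (h : IsTripleSymbol T) (e a b c d : A) :
    (T (e * (a * b)) c d - T (a * b) (c * e) d + T (a * b) c (e * d))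
      + (T (e * d) (c * a) b - T d (c * a * e) b + T d (c * a) (e * b))
      + (T (e * (b * c * a)) 1 d - T (b * c * a) (1 * e) d + T (b * c * a) 1 (e * d))
      + (T (e * d) (b * c) a - T d (b * c * e) a + T d (b * c) (e * a)) = 0 := by
  linear_combination (norm := (simp only [mul_assoc, one_mul]; abel))
    -h.factor a b (c * e) d + h.factor a b c (e * d) + h.factor (e * a) b c d
      - h.factor e b (c * a) d
      + h.add_reverse (e * d) (c * a) b - h.add_reverse d (c * a * e) b
      + h.add_reverse d (c * a) (e * b)
      + h.add_reverse (e * d) (b * c) a - h.add_reverse d (b * c * e) a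
      + h.add_reverse d (b * c) (e * a)
      - h.add_swap_left e (b * c * a) d

theorem action_one (h : IsTripleSymbol T) (e a : A) :
    T (e * 1) a 1 - T 1 (a * e) 1 + T 1 a (e * 1) = 0 := by
  linear_combination (norm := (simp only [mul_one]; abel))
    h.last_one_add e a - h.one_one (a * e)

/-- The action of a commutator factors through `x ⊗ y ⊗ z ↦ xyz - zyx`. -/
theorem action_commutator (h : IsTripleSymbol T) (p q x y z : A) :
    (T (p * q * x) y z - T x (y * (p * q)) z + T x y (p * q * z))
      - (T (q * p * x) y z - T x (y * (q * p)) z + T x y (q * p * z))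
      = T p q (x * y * z) + T (x * y * z) 1 (q * p)
        - (T p q (z * y * x) + T (z * y * x) 1 (q * p)) := by
  linear_combination (norm := (simp only [mul_assoc]; abel))
    h.factor (p * q) x y z + h.factor (q * p) z y x - h.factor p (q * z) y x
      - h.factor q (z * y) x p - h.factor p x q (z * y) - h.factor (p * x) y q z
      - h.factor p (x * y) z q - h.factor p q z (x * y) - h.factor p x y (q * z)
      - h.factor q z y (p * x) + h.cyclic (p * x) q (z * y) + h.cyclic (p * x * y) q z
      + h.cyclic (p * q) (x * y) z + h.cyclic (p * x) (z * y) q + h.cyclic (p * z * y) x q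
      + h.cyclic p (z * y) (x * q) - h.cyclic p (q * z * y) x + h.cyclic p q (z * y * x)
      + h.add_reverse (p * q * z) y x - h.add_reverse (q * p * z) y x
      - h.mid_one_add_swap (x * y * z) (q * p) + h.mid_one_add_swap (z * y * x) (q * p)
      + h.add_reverse x (y * q * p) z + h.add_swap_left (z * y) (q * p) x
      - h.add_reverse x (q * p) (z * y) + h.add_reverse p x (q * z * y)
      - h.add_swap_left x p (q * z * y) + h.add_reverse (q * z * y) p x
      - h.add_swap_left p (q * z * y) x - h.add_reverse p (x * q) (z * y)
      - h.add_reverse p (z * y * x) q + h.add_swap_left (z * y * x) p q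
      - h.add_reverse q p (z * y * x) + h.add_swap_left p q (z * y * x)
      - h.add_swap_left (q * p * x) y z + h.add_swap_left z (p * x * y) q
      - h.add_reverse q (p * x * y) z + h.add_swap_left (p * x * y) q z
      - h.add_reverse q (z * p) (x * y) - h.add_swap_left (x * y * z) p q
      + h.add_reverse q p (x * y * z) - h.add_swap_left p q (x * y * z)
      + h.add_swap_left z (p * q) (x * y) - h.add_reverse (x * y) (p * q) z
      + h.add_swap_left (p * q) (x * y) z - h.add_reverse (q * z) (y * p) x
      - h.add_swap_left (x * y) p (q * z) + h.add_reverse (q * z) p (x * y)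
      - h.add_swap_left p (q * z) (x * y) + h.add_reverse (p * x) y (q * z)
      - h.add_reverse (p * x) (y * q) z - h.add_reverse (p * x) (z * y) q
      + h.add_swap_left (z * y) (p * x) q - h.add_reverse q (p * x) (z * y)
      + h.add_swap_left (p * x) q (z * y) - h.mid_one_add_swap (q * z * y) (p * x)
      - h.mid_one_add_swap (q * z) (p * x * y) - h.mid_one_add_swap (x * y * z) (p * q)
      - h.mid_one_add_swap (x * q) (p * z * y)

end IsTripleSymbol

/-- The assignment `(a, ω) ↦ L_a(ω)`, `L_a(x⊗y⊗z) = ax⊗y⊗z − x⊗ya⊗z + x⊗y⊗az`,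
induces a well-defined left module structure on `H₁ = ker ∂₁ / im ∂₂` over the ring
`A/([A,A])`: for `a ∈ A` and a cycle `ω ∈ ker ∂₁`, `L_a(ω)` is again a cycle, its
class modulo `im ∂₂` depends only on the class of `a` in `A/([A,A])` and the class
of `ω` in `H₁`, and the resulting action `[a]·[ω] := [L_a(ω)]` satisfies the module
axioms (additivity in each variable, `[1]·[ω] = [ω]`, and `[a]·([b]·[ω]) = [ab]·[ω]`). -/
theorem La_induces_module_structure
    (k : Type u) [CommRing k] (A : Type v) [Ring A] [Algebra k A]
    (d₁ : A ⊗[k] (A ⊗[k] A) →ₗ[k] A)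
    (d₂ : ((A ⊗[k] (A ⊗[k] (A ⊗[k] A))) × A) →ₗ[k] A ⊗[k] (A ⊗[k] A))
    (h₁ : ∀ a b c : A, d₁ (a ⊗ₜ[k] (b ⊗ₜ[k] c)) = a * b * c - c * b * a)
    (h₂ : ∀ a b c d : A, d₂ (a ⊗ₜ[k] (b ⊗ₜ[k] (c ⊗ₜ[k] d)), 0) =
      (a * b) ⊗ₜ[k] (c ⊗ₜ[k] d) + d ⊗ₜ[k] ((c * a) ⊗ₜ[k] b) +
        (b * c * a) ⊗ₜ[k] ((1 : A) ⊗ₜ[k] d) + d ⊗ₜ[k] ((b * c) ⊗ₜ[k] a))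
    (h₃ : ∀ a : A, d₂ (0, a) = (1 : A) ⊗ₜ[k] (a ⊗ₜ[k] (1 : A)))
    (L : A → (A ⊗[k] (A ⊗[k] A) →ₗ[k] A ⊗[k] (A ⊗[k] A)))
    (hL : ∀ a x y z : A, L a (x ⊗ₜ[k] (y ⊗ₜ[k] z)) =
      (a * x) ⊗ₜ[k] (y ⊗ₜ[k] z) - x ⊗ₜ[k] ((y * a) ⊗ₜ[k] z) + x ⊗ₜ[k] (y ⊗ₜ[k] (a * z))) :
    -- boundaries are cycles, so `H₁ = ker ∂₁ / im ∂₂` makes sense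
    (LinearMap.range d₂ ≤ LinearMap.ker d₁)
    -- `L_a` sends cycles to cycles
    ∧ (∀ a : A, ∀ ω ∈ LinearMap.ker d₁, L a ω ∈ LinearMap.ker d₁)
    -- the class of `L_a ω` depends only on the class of `a` in `A/([A,A])`
    ∧ (∀ a b : A, a - b ∈ TwoSidedIdeal.span {x : A | ∃ y z : A, x = y * z - z * y} →
        ∀ ω ∈ LinearMap.ker d₁, L a ω - L b ω ∈ LinearMap.range d₂)
    -- the class of `L_a ω` depends only on the class of `ω` in `H₁`
    ∧ (∀ a : A, ∀ ω ∈ LinearMap.range d₂, L a ω ∈ LinearMap.range d₂)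
    -- additivity in `a`
    ∧ (∀ a b : A, ∀ ω ∈ LinearMap.ker d₁,
        L (a + b) ω - L a ω - L b ω ∈ LinearMap.range d₂)
    -- additivity in `ω`
    ∧ (∀ a : A, ∀ ω ω' : A ⊗[k] (A ⊗[k] A), L a (ω + ω') = L a ω + L a ω')
    -- `[1]·[ω] = [ω]`
    ∧ (∀ ω ∈ LinearMap.ker d₁, L 1 ω - ω ∈ LinearMap.range d₂)
    -- `[a]·([b]·[ω]) = [ab]·[ω]`
    ∧ (∀ a b : A, ∀ ω ∈ LinearMap.ker d₁,
        L a (L b ω) - L (a * b) ω ∈ LinearMap.range d₂) := by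
  have h_symbol : IsTripleSymbol fun a b c : A ↦
      (LinearMap.range d₂).mkQ (a ⊗ₜ[k] (b ⊗ₜ[k] c)) := by
    constructor
    · intro a
      rw [← h₃, Submodule.mkQ_apply, Submodule.Quotient.mk_eq_zero]
      exact ⟨_, rfl⟩
    · intro a b c d
      rw [← map_add, ← map_add, ← map_add, ← h₂, Submodule.mkQ_apply,
        Submodule.Quotient.mk_eq_zero]
      exact ⟨_, rfl⟩
  have h_range (ω) : ω ∈ LinearMap.range d₂ ↔ (LinearMap.range d₂).mkQ ω = 0 := by simp
  have h_boundary : d₁ ∘ₗ d₂ = 0 := by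
    refine LinearMap.prod_ext ?_ ?_
    · ext a b c d
      simp [h₁, h₂, mul_assoc]
    · ext a
      simp [h₁, h₃]
  have h_cycle (a : A) (ω) : d₁ (L a ω) = a * d₁ ω := by
    suffices d₁ ∘ₗ L a = LinearMap.mulLeft k a ∘ₗ d₁ from DFunLike.congr_fun this ω
    refine TensorProduct.ext_threefold' fun x y z ↦ ?_
    simp [h₁, hL, mul_assoc, mul_sub]
  have h_ker (a : A) (ω) (hω : ω ∈ LinearMap.ker d₁) : L a ω ∈ LinearMap.ker d₁ := by
    rw [LinearMap.mem_ker] at hω ⊢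
    rw [h_cycle, hω, mul_zero]
  have h_add (a b : A) : L (a + b) = L a + L b := by
    refine TensorProduct.ext_threefold' fun x y z ↦ ?_
    simp only [hL, LinearMap.add_apply, add_mul, mul_add, TensorProduct.add_tmul,
      TensorProduct.tmul_add]
    abel
  have h_sub (a b : A) (ω) : L (a - b) ω = L a ω - L b ω :=
    eq_sub_of_add_eq (by rw [← LinearMap.add_apply, ← h_add, sub_add_cancel])
  have h_zero : L 0 = 0 :=
    TensorProduct.ext_threefold' fun x y z ↦ by simp [hL]
  have h_one : L 1 = LinearMap.id :=
    TensorProduct.ext_threefold' fun x y z ↦ by simp [hL]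
  have h_mul (a b : A) (ω) : L a (L b ω) - L (a * b) ω ∈ LinearMap.range d₂ := by
    rw [h_range, map_sub, sub_eq_zero]
    suffices (LinearMap.range d₂).mkQ ∘ₗ L a ∘ₗ L b = (LinearMap.range d₂).mkQ ∘ₗ L (a * b) from
      DFunLike.congr_fun this ω
    refine TensorProduct.ext_threefold' fun x y z ↦ ?_
    simpa only [LinearMap.comp_apply, hL, map_add, map_sub] using h_symbol.action_mul a b x y z
  have h_stable (a : A) (ω) (hω : ω ∈ LinearMap.range d₂) : L a ω ∈ LinearMap.range d₂ := by
    obtain ⟨w, rfl⟩ := hω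
    rw [h_range]
    suffices (LinearMap.range d₂).mkQ ∘ₗ L a ∘ₗ d₂ = 0 from DFunLike.congr_fun this w
    refine LinearMap.prod_ext ?_ ?_
    · ext x y z t
      simpa [h₂, hL] using h_symbol.action_rel a x y z t
    · ext x
      simpa [h₃, hL] using h_symbol.action_one a x
  have h_commutator (p q : A) (ω) (hω : d₁ ω = 0) :
      L (p * q - q * p) ω ∈ LinearMap.range d₂ := by
    let φ : A →ₗ[k] A ⊗[k] (A ⊗[k] A) :=
      TensorProduct.mk k A (A ⊗[k] A) p ∘ₗ TensorProduct.mk k A A q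
        + (TensorProduct.mk k A (A ⊗[k] A)).flip (1 ⊗ₜ[k] (q * p))
    suffices (LinearMap.range d₂).mkQ ∘ₗ L (p * q - q * p) =
        (LinearMap.range d₂).mkQ ∘ₗ φ ∘ₗ d₁ by
      rw [h_range]
      simpa [hω] using DFunLike.congr_fun this ω
    refine TensorProduct.ext_threefold' fun x y z ↦ ?_
    simpa only [φ, h_sub, LinearMap.comp_apply, LinearMap.add_apply, hL, h₁,
      map_add, map_sub, TensorProduct.mk_apply, LinearMap.flip_apply] using
      h_symbol.action_commutator p q x y z
  have h_ideal (u : A) (hu : u ∈ TwoSidedIdeal.span {x : A | ∃ y z : A, x = y * z - z * y}) :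
      ∀ ω ∈ LinearMap.ker d₁, L u ω ∈ LinearMap.range d₂ := by
    induction hu using TwoSidedIdeal.span_induction with
    | mem u hu =>
      obtain ⟨p, q, rfl⟩ := hu
      exact fun ω hω ↦ h_commutator p q ω hω
    | zero =>
      intro ω _
      simp [h_zero]
    | add x y _ _ hx hy =>
      intro ω hω
      rw [h_add]
      exact add_mem (hx ω hω) (hy ω hω)
    | neg x _ hx =>
      intro ω hω
      have h_neg : L (-x) ω = -L x ω :=
        eq_neg_of_add_eq_zero_left (by
          rw [← LinearMap.add_apply, ← h_add, neg_add_cancel, h_zero, LinearMap.zero_apply])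
      rw [h_neg]
      exact neg_mem (hx ω hω)
    | left_absorb a x _ hx =>
      intro ω hω
      exact ((LinearMap.range d₂).sub_mem_iff_right (h_stable a _ (hx ω hω))).1 (h_mul a x ω)
    | right_absorb b x _ hx =>
      intro ω hω
      exact ((LinearMap.range d₂).sub_mem_iff_right (hx _ (h_ker b ω hω))).1 (h_mul x b ω)
  refine ⟨LinearMap.range_le_ker_iff.2 h_boundary, h_ker, ?_, h_stable, ?_, ?_, ?_, ?_⟩
  · intro a b hab ω hω
    simpa only [h_sub] using h_ideal (a - b) hab ω hω
  · intro a b ω _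
    simp [h_add]
  · exact fun a ω ω' ↦ map_add (L a) ω ω'
  · intro ω _
    simp [h_one]
  · exact fun a b ω _ ↦ h_mul a b ω
end

section
/- Let A be a unital associative algebra over a commutative ring k such that the two-sided ideal generated by all commutators xy − yx equals A itself, i.e., ([A,A]) = A. Then the zeroth and first homology of the partial complex both vanish: im ∂₁ = A and ker ∂₁ = im ∂₂. In particular HS₀(A) = 0 and HS₁(A) = 0. -/
open TensorProduct

/-- `F a b c` behaves like the class of `a ⊗ b ⊗ c` modulo the image of `∂₂`: it is a cocycle for
the reversals `abc ↦ cba` of words. -/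
structure IsReversalCocycle {A Q : Type*} [Monoid A] [AddCommGroup Q] (F : A → A → A → Q) :
    Prop where
  rel (a b c d : A) : F (a * b) c d + F d (c * a) b + F (b * c * a) 1 d + F d (b * c) a = 0
  unit (a : A) : F 1 a 1 = 0

/-- The value of `F` on the swap `abc ↦ bac` of the first two blocks of a word, obtained as the
reversal `abc ↦ cba` followed by the rotation `cba ↦ bac`. -/
def swapOf {A Q : Type*} [Monoid A] [AddCommGroup Q] (F : A → A → A → Q) (a b c : A) : Q :=
  F a b c + F c 1 (b * a)

/-- The value of `F` on the path `abce ↦ bace ↦ cbae`, which reverses `abc` in front of `e`. -/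
def insertRight {A Q : Type*} [Monoid A] [AddCommGroup Q] (F : A → A → A → Q)
    (e a b c : A) : Q :=
  swapOf F a b (c * e) + swapOf F (b * a) c e

namespace IsReversalCocycle

variable {A Q : Type*} [Monoid A] [AddCommGroup Q] {F : A → A → A → Q}

theorem unit_unit_right (hF : IsReversalCocycle F) (a : A) : F a 1 1 = 0 := by
  have h₁ := hF.rel 1 1 a 1
  have h₂ := hF.unit a
  have h₃ := hF.rel a 1 1 1
  have h₄ := hF.rel 1 a 1 1
  simp only [one_mul, mul_one] at h₁ h₃ h₄
  grind

theorem unit_unit_left (hF : IsReversalCocycle F) (a : A) : F 1 1 a = 0 := by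
  have h₁ := hF.rel a 1 1 1
  have h₂ := hF.unit a
  have h₃ := hF.unit_unit_right a
  simp only [one_mul, mul_one] at h₁
  grind

theorem rotate_anti (hF : IsReversalCocycle F) (a b : A) : F a 1 b + F b 1 a = 0 := by
  have h₁ := hF.rel 1 1 a b
  have h₂ := hF.rel 1 a 1 b
  have h₃ := hF.rel 1 a b 1
  have h₄ := hF.rel 1 b a 1
  have h₆ := hF.unit_unit_right (b * a)
  have h₈ := hF.unit (b * a)
  simp only [one_mul, mul_one] at h₁ h₂ h₃ h₄
  grind

theorem unit_left (hF : IsReversalCocycle F) (a b : A) : F 1 a b = F a 1 b := by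
  have h₁ := hF.rel 1 1 a b
  have h₂ := hF.rel 1 a 1 b
  have h₃ := hF.rotate_anti a b
  simp only [one_mul, mul_one] at h₁ h₂
  grind

theorem unit_right (hF : IsReversalCocycle F) (a b : A) : F a b 1 = F a 1 b := by
  have h₁ := hF.rel 1 1 b a
  have h₂ := hF.rel 1 b 1 a
  have h₃ := hF.rotate_anti a b
  simp only [one_mul, mul_one] at h₁ h₂
  grind

theorem anti (hF : IsReversalCocycle F) (a b c : A) : F a b c + F c b a = 0 := by
  have h₁ := hF.rel 1 a b c
  have h₂ := hF.rotate_anti (a * b) c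
  have h₃ := hF.unit_right c (a * b)
  simp only [one_mul, mul_one] at h₁
  grind

theorem rotate_rotate (hF : IsReversalCocycle F) (a b c : A) :
    F (a * b) 1 c + F (b * c) 1 a + F (c * a) 1 b = 0 := by
  have h₁ := hF.rel a b c 1
  have h₂ := hF.unit_unit_right (b * c * a)
  have h₃ := hF.unit_right (a * b) c
  have h₄ := hF.unit_left (c * a) b
  have h₅ := hF.unit_left (b * c) a
  grind

theorem swapOf_anti (hF : IsReversalCocycle F) (a b c : A) :
    swapOf F a b c + swapOf F b a c = 0 := by
  have h₁ := hF.rel a b 1 c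
  have h₂ := hF.anti a b c
  have h₃ := hF.anti b a c
  have h₄ := hF.rotate_anti (a * b) c
  have h₅ := hF.rotate_anti (b * a) c
  simp only [mul_one, one_mul] at h₁
  unfold swapOf
  grind

theorem swapOf_mul (hF : IsReversalCocycle F) (a b c d : A) :
    swapOf F (a * b) c d = swapOf F a (b * c) d + swapOf F b (c * a) d := by
  have h₁ := hF.rel a b c d
  have h₂ := hF.anti d (c * a) b
  have h₃ := hF.anti d (b * c) a
  have h₄ := hF.rotate_anti (b * c * a) d
  simp only [swapOf, mul_assoc] at *
  grind

theorem swapOf_rotate (hF : IsReversalCocycle F) (a b c : A) :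
    swapOf F a b c = swapOf F b c a + F a 1 (b * c) + F c 1 (b * a) := by
  have h₁ := hF.swapOf_anti c b a
  have h₂ := hF.anti a b c
  unfold swapOf at *
  grind

theorem swapOf_unit_middle (hF : IsReversalCocycle F) (a c : A) : swapOf F a 1 c = 0 := by
  simpa [swapOf] using hF.rotate_anti a c

theorem swapOf_unit_left (hF : IsReversalCocycle F) (a c : A) : swapOf F 1 a c = 0 := by
  simpa [swapOf, hF.unit_left] using hF.rotate_anti a c

theorem swapOf_unit_right (hF : IsReversalCocycle F) (a b : A) : swapOf F a b 1 = F a 1 b := by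
  simp [swapOf, hF.unit_right, hF.unit_unit_left]

/-- The two ways of passing from `abcd` to `cbad` by swaps agree. -/
theorem swapOf_braid (hF : IsReversalCocycle F) (a b c d : A) :
    swapOf F a (b * c) d + swapOf F b c (a * d) =
      swapOf F a b (c * d) + swapOf F (b * a) c d := by
  have h₁ := hF.swapOf_mul b c d a
  have h₂ := hF.swapOf_mul b a d c
  have r₁ := hF.swapOf_rotate a (b * c) d
  have r₂ := hF.swapOf_rotate d (b * a) c
  have r₃ := hF.swapOf_rotate a b (c * d)
  have r₄ := hF.swapOf_rotate (a * d) b c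
  have r₅ := hF.swapOf_rotate a (d * b) c
  have t₁ := hF.swapOf_anti (b * a) d c
  have t₂ := hF.swapOf_anti b (a * d) c
  have t₃ := hF.swapOf_anti c (d * b) a
  have s₁ := hF.rotate_rotate a d (b * c)
  have s₂ := hF.rotate_rotate c d (b * a)
  have u₁ := hF.rotate_anti a (d * (b * c))
  have u₂ := hF.rotate_anti d (b * (c * a))
  have u₃ := hF.rotate_anti c (d * (b * a))
  have u₄ := hF.rotate_anti d (b * (a * c))
  simp only [mul_assoc] at *
  grind

theorem swapOf_cyclic (hF : IsReversalCocycle F) (a b c d : A) :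
    swapOf F c d (a * b) + swapOf F a d (b * c) + swapOf F b d (c * a) =
      F c 1 (d * (a * b)) + F a 1 (d * (b * c)) + F b 1 (d * (c * a)) := by
  have h₁ := hF.swapOf_mul a b c d
  have r₁ := hF.swapOf_rotate (a * b) c d
  have r₂ := hF.swapOf_rotate a (b * c) d
  have r₃ := hF.swapOf_rotate (b * c) d a
  have r₄ := hF.swapOf_rotate b (c * a) d
  have r₅ := hF.swapOf_rotate (c * a) d b
  have t₁ := hF.swapOf_anti a d (b * c)
  have t₂ := hF.swapOf_anti b d (c * a)
  have s₁ := hF.rotate_rotate a b (c * d)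
  have u₁ := hF.rotate_anti a (b * (c * d))
  have s₂ := hF.rotate_rotate b c (d * a)
  have u₂ := hF.rotate_anti c (d * (a * b))
  have u₃ := hF.rotate_anti b (c * (a * d))
  have u₄ := hF.rotate_anti (c * a) (d * b)
  have s₃ := hF.rotate_rotate d b (c * a)
  have u₅ := hF.rotate_anti d (b * (c * a))
  simp only [mul_assoc] at *
  grind

/-- Swapping `a, b` commutes with swapping `c, d` in the cyclic word `abcd`. -/
theorem swapOf_comm (hF : IsReversalCocycle F) (a b c d : A) :
    swapOf F a b (c * d) + F (b * a) 1 (c * d) + swapOf F c d (b * a) + F (d * c) 1 (b * a) +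
      swapOf F b a (d * c) + F (a * b) 1 (d * c) + swapOf F d c (a * b) + F (c * d) 1 (a * b)
      = 0 := by
  have h₁ := hF.swapOf_cyclic a b c d
  have h₂ := hF.swapOf_cyclic b c d a
  have h₃ := hF.swapOf_cyclic b a d c
  have h₄ := hF.swapOf_cyclic c a d b
  have t₁ := hF.swapOf_anti a b (c * d)
  have t₂ := hF.swapOf_anti a b (d * c)
  have t₃ := hF.swapOf_anti a c (d * b)
  have t₄ := hF.swapOf_anti a d (b * c)
  have t₅ := hF.swapOf_anti b c (a * d)
  have t₆ := hF.swapOf_anti b d (c * a)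
  have t₇ := hF.swapOf_anti c d (a * b)
  have t₈ := hF.swapOf_anti c d (b * a)
  have s₁ := hF.rotate_rotate c d (a * b)
  have u₁ := hF.rotate_anti c (d * (a * b))
  have u₂ := hF.rotate_anti d (a * (b * c))
  have s₂ := hF.rotate_rotate a b (d * c)
  have u₃ := hF.rotate_anti a (b * (d * c))
  have u₄ := hF.rotate_anti b (d * (c * a))
  have u₅ := hF.rotate_anti a (c * (d * b))
  have s₃ := hF.rotate_rotate b a (c * d)
  have u₆ := hF.rotate_anti b (a * (c * d))
  have u₇ := hF.rotate_anti a (d * (b * c))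
  have s₄ := hF.rotate_rotate d b (c * a)
  have u₈ := hF.rotate_anti d (b * (c * a))
  have u₉ := hF.rotate_anti (d * b) (c * a)
  have u₁₀ := hF.rotate_anti b (c * (a * d))
  have s₅ := hF.rotate_rotate c a (d * b)
  have u₁₁ := hF.rotate_anti c (a * (d * b))
  have s₆ := hF.rotate_rotate d c (b * a)
  have u₁₂ := hF.rotate_anti d (c * (b * a))
  have u₁₃ := hF.rotate_anti c (b * (a * d))
  simp only [mul_assoc] at *
  grind

theorem insertRight_unit_middle (hF : IsReversalCocycle F) (e a b : A) :
    insertRight F e a 1 b = swapOf F a b e := by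
  simp [insertRight, hF.swapOf_unit_middle]

theorem insertRight_one (hF : IsReversalCocycle F) (a b c : A) :
    insertRight F 1 a b c = F a b c := by
  have h := hF.rotate_anti c (b * a)
  simp only [insertRight, mul_one, hF.swapOf_unit_right]
  simp only [swapOf]
  grind

theorem swapOf_insertRight (hF : IsReversalCocycle F) (e a b c : A) :
    swapOf (insertRight F e) a b c = swapOf F a b (c * e) := by
  have h := hF.swapOf_anti (b * a) c e
  rw [swapOf, hF.insertRight_unit_middle, insertRight]
  grind

theorem isReversalCocycle_insertRight (hF : IsReversalCocycle F) (e : A) :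
    IsReversalCocycle (insertRight F e) where
  rel a b c d := by
    have h₁ := hF.swapOf_mul a b c (d * e)
    have h₂ := hF.swapOf_braid d (c * a) b e
    have h₃ := hF.swapOf_braid d (b * c) a e
    have h₄ := hF.swapOf_anti (c * a) b (d * e)
    have h₅ := hF.swapOf_anti (b * c) a (d * e)
    have h₆ := hF.swapOf_anti (c * (a * b)) d e
    have h₇ := hF.swapOf_anti (b * (c * a)) d e
    rw [hF.insertRight_unit_middle]
    simp only [insertRight, mul_assoc] at *
    grind
  unit a := by
    simp [insertRight, hF.swapOf_unit_left, hF.swapOf_unit_middle]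

theorem insertRight_insertRight (hF : IsReversalCocycle F) (e f a b c : A) :
    insertRight (insertRight F f) e a b c = insertRight F (e * f) a b c := by
  rw [insertRight, hF.swapOf_insertRight, hF.swapOf_insertRight, insertRight, mul_assoc]

theorem swapOf_rotate_conj (hF : IsReversalCocycle F) (p x y f : A) :
    swapOf F p (x * y) f + swapOf F x y (p * f) =
      F p 1 (x * (y * f)) + swapOf F x y (f * p) + F (y * (x * f)) 1 p
        + swapOf F p (y * x) f := by
  have h := hF.swapOf_comm x y p f
  have r₁ := hF.swapOf_rotate f p (x * y)
  have r₂ := hF.swapOf_rotate f p (y * x)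
  have t₁ := hF.swapOf_anti x y (f * p)
  have t₂ := hF.swapOf_anti p f (y * x)
  have s₁ := hF.rotate_rotate p (x * y) f
  have s₂ := hF.rotate_rotate p (y * x) f
  have u₁ := hF.rotate_anti (p * f) (x * y)
  have u₂ := hF.rotate_anti (f * p) (x * y)
  have u₃ := hF.rotate_anti f (p * (x * y))
  have u₄ := hF.rotate_anti f (p * (y * x))
  have u₅ := hF.rotate_anti p (x * (y * f))
  simp only [mul_assoc] at *
  grind

theorem swapOf_commutator (hF : IsReversalCocycle F) (x y a b c : A) :
    swapOf F a b (c * (x * y)) - swapOf F a b (c * (y * x)) =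
      (F (a * (b * c)) 1 (x * y) + swapOf F x y (a * (b * c)) + F (y * x) 1 (a * (b * c))) -
      (F (b * (a * c)) 1 (x * y) + swapOf F x y (b * (a * c)) + F (y * x) 1 (b * (a * c))) := by
  have h := (hF.isReversalCocycle_insertRight c).swapOf_comm x y a b
  simp only [hF.swapOf_insertRight, hF.insertRight_unit_middle] at h
  have h₁ := hF.swapOf_rotate_conj (x * y) a b c
  have h₂ := hF.swapOf_rotate_conj (y * x) a b c
  have t₁ := hF.swapOf_anti a b (x * (y * c))
  have t₂ := hF.swapOf_anti x y (b * (a * c))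
  have t₃ := hF.swapOf_anti (x * y) (a * b) c
  have t₄ := hF.swapOf_anti (y * x) (b * a) c
  have u₁ := hF.rotate_anti (x * y) (a * (b * c))
  have u₂ := hF.rotate_anti (y * x) (b * (a * c))
  simp only [mul_assoc] at *
  grind

/-- Up to the value of `F` on a path depending only on the end points `abc` and `cba`, reversing
`abc` in front of `xy` is the same as reversing it in front of `yx`. -/
theorem insertRight_commutator (hF : IsReversalCocycle F) (x y a b c : A) :
    insertRight F (x * y) a b c - insertRight F (y * x) a b c =
      (F (a * b * c) 1 (x * y) + swapOf F x y (a * b * c) + F (y * x) 1 (a * b * c)) -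
      (F (c * b * a) 1 (x * y) + swapOf F x y (c * b * a) + F (y * x) 1 (c * b * a)) := by
  have h₁ := hF.swapOf_commutator x y a b c
  have h₂ := hF.swapOf_commutator x y (b * a) c 1
  simp only [insertRight, mul_assoc, one_mul, mul_one] at *
  grind

end IsReversalCocycle

section Tensor

variable {k A : Type*} [CommRing k] [Ring A] [Algebra k A]

/-- The linear map `a ⊗ b ⊗ c ↦ c ⊗ ba`. -/
noncomputable def tensorRotate (k A : Type*) [CommRing k] [Ring A] [Algebra k A] :
    A ⊗[k] (A ⊗[k] A) →ₗ[k] A ⊗[k] A :=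
  (LinearMap.mul' k A ∘ₗ (TensorProduct.comm k A A).toLinearMap).lTensor A ∘ₗ
    (TensorProduct.comm k (A ⊗[k] A) A).toLinearMap ∘ₗ
      (TensorProduct.assoc k A A A).symm.toLinearMap

theorem tensorRotate_tmul (a b c : A) :
    tensorRotate k A (a ⊗ₜ (b ⊗ₜ c)) = c ⊗ₜ (b * a) := by
  simp [tensorRotate]

/-- The linear map `a ⊗ b ⊗ c ↦ a ⊗ b ⊗ c + c ⊗ 1 ⊗ ba` lifting `swapOf`. -/
noncomputable def tensorSwap (k A : Type*) [CommRing k] [Ring A] [Algebra k A] :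
    A ⊗[k] (A ⊗[k] A) →ₗ[k] A ⊗[k] (A ⊗[k] A) :=
  LinearMap.id + (TensorProduct.mk k A A 1).lTensor A ∘ₗ tensorRotate k A

/-- The lift of `insertRight` to the tensor cube of `A`. -/
noncomputable def tensorInsertRight (k A : Type*) [CommRing k] [Ring A] [Algebra k A] :
    A →+ (A ⊗[k] (A ⊗[k] A) →ₗ[k] A ⊗[k] (A ⊗[k] A)) :=
  AddMonoidHom.mk' (fun e => tensorSwap k A ∘ₗ
    (((LinearMap.mulRight k e).lTensor A).lTensor A +
      ((TensorProduct.mk k A A).flip e).lTensor A ∘ₗ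
        (TensorProduct.comm k A A).toLinearMap ∘ₗ tensorRotate k A)) <| by
    intro e f
    ext a b c
    simp only [AlgebraTensorModule.curry_apply, curry_apply, LinearMap.coe_restrictScalars,
      LinearMap.comp_apply, LinearMap.add_apply, LinearMap.lTensor_tmul,
      LinearMap.mulRight_apply, LinearEquiv.coe_coe, tensorRotate_tmul, comm_tmul,
      LinearMap.flip_apply, mk_apply, mul_add, tmul_add, map_add]
    abel

theorem map_tensorInsertRight_tmul {Q : Type*} [AddCommGroup Q] [Module k Q]
    (φ : A ⊗[k] (A ⊗[k] A) →ₗ[k] Q) (e a b c : A) :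
    φ (tensorInsertRight k A e (a ⊗ₜ (b ⊗ₜ c))) =
      insertRight (fun a b c => φ (a ⊗ₜ (b ⊗ₜ c))) e a b c := by
  simp only [tensorInsertRight, AddMonoidHom.mk'_apply, tensorSwap, insertRight, swapOf,
      LinearMap.comp_apply, LinearMap.add_apply, LinearMap.lTensor_tmul, LinearMap.id_apply,
      LinearMap.mulRight_apply, LinearEquiv.coe_coe, tensorRotate_tmul, comm_tmul,
      LinearMap.flip_apply, mk_apply, map_add]

end Tensor

/-- If the commutators of `A` generate the unit ideal, then an additive subgroup of `A` that
contains all commutators and is stable under right multiplication is all of `A`. -/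
theorem AddSubgroup.eq_top_of_commutator_mem {A : Type*} [Ring A]
    (hcomm : TwoSidedIdeal.span {x : A | ∃ y z : A, x = y * z - z * y} = ⊤)
    (J : AddSubgroup A) (hJ : ∀ x y : A, x * y - y * x ∈ J) (hmul : ∀ x ∈ J, ∀ y, x * y ∈ J) :
    J = ⊤ := by
  let I : TwoSidedIdeal A := TwoSidedIdeal.mk' J J.zero_mem J.add_mem J.neg_mem
    (fun {x y} hy => by simpa using J.add_mem (hJ x y) (hmul y hy x))
    (fun {x y} hx => hmul x hx y)
  have hI : TwoSidedIdeal.span {x : A | ∃ y z : A, x = y * z - z * y} ≤ I := by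
    rw [TwoSidedIdeal.span_le]
    rintro _ ⟨y, z, rfl⟩
    simpa [I] using hJ y z
  rw [eq_top_iff]
  intro x _
  have hx : x ∈ I := hI (hcomm ▸ trivial)
  simpa [I] using hx

/-- If the two-sided ideal of `A` generated by all commutators equals `A` itself,
then the zeroth and first homology of the partial complex both vanish:
`im ∂₁ = A` and `ker ∂₁ = im ∂₂`. In particular `HS₀(A) = 0` and `HS₁(A) = 0`. -/
theorem homology_vanishes_of_commutator_ideal_eq_top
    (k : Type u) [CommRing k] (A : Type v) [Ring A] [Algebra k A]
    (d₁ : A ⊗[k] (A ⊗[k] A) →ₗ[k] A)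
    (d₂ : ((A ⊗[k] (A ⊗[k] (A ⊗[k] A))) × A) →ₗ[k] A ⊗[k] (A ⊗[k] A))
    (h₁ : ∀ a b c : A, d₁ (a ⊗ₜ[k] (b ⊗ₜ[k] c)) = a * b * c - c * b * a)
    (h₂ : ∀ a b c d : A, d₂ (a ⊗ₜ[k] (b ⊗ₜ[k] (c ⊗ₜ[k] d)), 0) =
      (a * b) ⊗ₜ[k] (c ⊗ₜ[k] d) + d ⊗ₜ[k] ((c * a) ⊗ₜ[k] b) +
        (b * c * a) ⊗ₜ[k] ((1 : A) ⊗ₜ[k] d) + d ⊗ₜ[k] ((b * c) ⊗ₜ[k] a))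
    (h₃ : ∀ a : A, d₂ (0, a) = (1 : A) ⊗ₜ[k] (a ⊗ₜ[k] (1 : A)))
    (hcomm : TwoSidedIdeal.span {x : A | ∃ y z : A, x = y * z - z * y} = ⊤) :
    LinearMap.range d₁ = ⊤ ∧ LinearMap.ker d₁ = LinearMap.range d₂ := by
  have hle : LinearMap.range d₂ ≤ d₁.ker := by
    rw [LinearMap.range_le_ker_iff]
    ext
    · simp [h₁, h₂, mul_assoc]
    · simp [h₁, h₃]
  have d₁_insertRight (e : A) (u : A ⊗[k] (A ⊗[k] A)) :
      d₁ (tensorInsertRight k A e u) = d₁ u * e := by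
    suffices h : d₁ ∘ₗ tensorInsertRight k A e = LinearMap.mulRight k e ∘ₗ d₁ from
      LinearMap.congr_fun h u
    ext a b c
    simp [map_tensorInsertRight_tmul, insertRight, swapOf, h₁, mul_assoc, sub_mul]
  refine ⟨?_, le_antisymm (fun z hz => ?_) hle⟩
  · rw [← Submodule.toAddSubgroup_inj, Submodule.top_toAddSubgroup]
    refine AddSubgroup.eq_top_of_commutator_mem hcomm _ (fun x y => ?_) ?_
    · exact ⟨x ⊗ₜ (1 ⊗ₜ y), by simp [h₁]⟩
    · rintro _ ⟨u, rfl⟩ e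
      exact ⟨_, d₁_insertRight e u⟩
  let π := (LinearMap.range d₂).mkQ
  have hπ : IsReversalCocycle fun a b c => π (a ⊗ₜ[k] (b ⊗ₜ[k] c)) := by
    constructor
    · intro a b c d
      simp only [← map_add, ← h₂]
      exact (Submodule.Quotient.mk_eq_zero _).2 ⟨_, rfl⟩
    · intro a
      exact (Submodule.Quotient.mk_eq_zero _).2 ⟨_, h₃ a⟩
  have hπ_ker : π.ker = LinearMap.range d₂ := Submodule.ker_mkQ _
  let J : AddSubgroup A :=
    { carrier := {e | ∀ z ∈ d₁.ker, tensorInsertRight k A e z ∈ LinearMap.range d₂}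
      zero_mem' := fun z _ => by simp
      add_mem' := fun he hf z hz => by
        simpa using add_mem (he z hz) (hf z hz)
      neg_mem' := fun he z hz => by
        simpa using neg_mem (he z hz) }
  have hJ : J = ⊤ := by
    refine AddSubgroup.eq_top_of_commutator_mem hcomm J (fun x y z hz => ?_) (fun e he f z hz => ?_)
    · let H : A →ₗ[k] A ⊗[k] (A ⊗[k] A) :=
        (TensorProduct.mk k A (A ⊗[k] A)).flip (1 ⊗ₜ (x * y)) +
          tensorSwap k A ∘ₗ TensorProduct.mk k A (A ⊗[k] A) x ∘ₗ TensorProduct.mk k A A y +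
          TensorProduct.mk k A (A ⊗[k] A) (y * x) ∘ₗ TensorProduct.mk k A A 1
      have hH : π ∘ₗ tensorInsertRight k A (x * y - y * x) = π ∘ₗ H ∘ₗ d₁ := by
        ext a b c
        have h := hπ.insertRight_commutator x y a b c
        simp only [← map_tensorInsertRight_tmul] at h
        simp only [swapOf] at h
        simp [H, h₁, tensorSwap, tensorRotate_tmul, h, tmul_sub]
        abel
      rw [← hπ_ker, LinearMap.mem_ker]
      simpa [LinearMap.mem_ker.1 hz] using LinearMap.congr_fun hH z
    · have hf : π ∘ₗ tensorInsertRight k A (e * f) =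
          π ∘ₗ tensorInsertRight k A f ∘ₗ tensorInsertRight k A e := by
        ext a b c
        have h := map_tensorInsertRight_tmul (π ∘ₗ tensorInsertRight k A f) e a b c
        simp only [LinearMap.comp_apply, map_tensorInsertRight_tmul,
          hπ.insertRight_insertRight] at h
        simp [h, map_tensorInsertRight_tmul]
      have hle_f : LinearMap.range d₂ ≤ (π ∘ₗ tensorInsertRight k A f).ker := by
        have h := hπ.isReversalCocycle_insertRight f
        rw [LinearMap.range_le_ker_iff]
        ext a b c d
        · simpa [h₂, map_tensorInsertRight_tmul] using h.rel a b c d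
        · simpa [h₃, map_tensorInsertRight_tmul] using h.unit _
      rw [← hπ_ker, LinearMap.mem_ker]
      exact (LinearMap.congr_fun hf z).trans (hle_f (he z hz))
  have h_one : π ∘ₗ tensorInsertRight k A 1 = π := by
    ext a b c
    simp [map_tensorInsertRight_tmul, hπ.insertRight_one]
  have hz_one : tensorInsertRight k A 1 z ∈ LinearMap.range d₂ :=
    (hJ ▸ AddSubgroup.mem_top (1 : A) : (1 : A) ∈ J) z hz
  rw [← hπ_ker, LinearMap.mem_ker] at hz_one ⊢
  rw [← h_one]
  exact hz_one
end

section
/- For A = ℤ[t]/(t²), the first homology of the partial complex, H₁ = ker ∂₁ / im ∂₂, is isomorphic as an abelian group to ℤ/2ℤ ⊕ ℤ/2ℤ; that is, HS₁(ℤ[t]/(t²)) ≅ ℤ/2ℤ ⊕ ℤ/2ℤ. -/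
open TensorProduct

set_option synthInstance.maxHeartbeats 1000000
set_option maxHeartbeats 1000000

/-- The algebra `A = ℤ[t]/(t^2)`. -/
noncomputable abbrev A : Type :=
  Polynomial ℤ ⧸ Ideal.span ({Polynomial.X ^ 2} : Set (Polynomial ℤ))

namespace HS1

/-- The class of `t` in `A`. -/
noncomputable def t : A := Ideal.Quotient.mk _ Polynomial.X

lemma t_mul_t : t * t = 0 := by
  rw [t, ← map_mul, ← pow_two, Ideal.Quotient.eq_zero_iff_mem]
  exact Ideal.subset_span rfl

lemma exists_eq_add_smul_t (a : A) : ∃ m n : ℤ, a = m • (1 : A) + n • t := by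
  obtain ⟨p, rfl⟩ := Ideal.Quotient.mk_surjective a
  refine ⟨p.coeff 0, p.divX.coeff 0, ?_⟩
  conv_lhs => rw [← p.divX_mul_X_add, ← p.divX.divX_mul_X_add]
  simp only [map_add, map_mul, eq_intCast, map_intCast, zsmul_eq_mul, mul_one]
  change (_ * t + _) * t + _ = _
  linear_combination (Ideal.Quotient.mk _ p.divX.divX) * t_mul_t

/-- Reduction modulo `2`, as a map to the dual numbers over `ZMod 2`. -/
noncomputable def toDual : A →+* DualNumber (ZMod 2) :=
  Ideal.Quotient.lift _ (Polynomial.aeval (R := ℤ) (DualNumber.eps (R := ZMod 2))).toRingHom <| by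
    intro p hp
    obtain ⟨q, rfl⟩ := Ideal.mem_span_singleton.1 hp
    simp [pow_two]

lemma toDual_t : toDual t = DualNumber.eps := by
  simp [toDual, t]

/-- The constant coefficient modulo `2`. -/
noncomputable def constCoeff : A →+ ZMod 2 :=
  (TrivSqZeroExt.fstHom ℤ (ZMod 2) (ZMod 2)).toAddMonoidHom.comp toDual.toAddMonoidHom

/-- The coefficient of `t` modulo `2`. -/
noncomputable def tCoeff : A →+ ZMod 2 :=
  (TrivSqZeroExt.sndHom (ZMod 2) (ZMod 2)).toAddMonoidHom.comp toDual.toAddMonoidHom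

lemma constCoeff_mul (a b : A) : constCoeff (a * b) = constCoeff a * constCoeff b := by
  simp [constCoeff]

lemma tCoeff_mul (a b : A) :
    tCoeff (a * b) = constCoeff a * tCoeff b + constCoeff b * tCoeff a := by
  simp [constCoeff, tCoeff, mul_comm]

@[simp] lemma constCoeff_one : constCoeff 1 = 1 := by simp [constCoeff]
@[simp] lemma tCoeff_one : tCoeff 1 = 0 := by simp [tCoeff]
@[simp] lemma constCoeff_t : constCoeff t = 0 := by simp [constCoeff, toDual_t]
@[simp] lemma tCoeff_t : tCoeff t = 1 := by simp [tCoeff, toDual_t]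

section TensorProduct

variable {M N : Type*} [AddCommGroup M] [AddCommGroup N] [Module ℤ M] [Module ℤ N]

/-- The product of two additive functionals, as a functional on the tensor product. -/
noncomputable def tensorMul (f : M →+ ZMod 2) (g : N →+ ZMod 2) : M ⊗[ℤ] N →+ ZMod 2 :=
  liftAddHom ((AddMonoidHom.mul.comp f).compl₂ g) fun r m n => by
    have hf := map_intCast_smul f ℤ ℤ r m
    have hg := map_intCast_smul g ℤ ℤ r n
    simp only [Int.cast_id] at hf hg
    simp [hf, hg, mul_left_comm, mul_assoc]

@[simp] lemma tensorMul_tmul (f : M →+ ZMod 2) (g : N →+ ZMod 2) (m : M) (n : N) :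
    tensorMul f g (m ⊗ₜ n) = f m * g n := rfl

/-- Tensoring on the left with a fixed element, as an additive map. -/
noncomputable def tmulLeft (N : Type*) [AddCommGroup N] [Module ℤ N] (m : M) : N →+ M ⊗[ℤ] N :=
  AddMonoidHom.mk' (fun n => m ⊗ₜ n) (tmul_add m)

/-- Tensoring on the right with a fixed element, as an additive map. -/
noncomputable def tmulRight (M : Type*) [AddCommGroup M] [Module ℤ M] (n : N) : M →+ M ⊗[ℤ] N :=
  AddMonoidHom.mk' (fun m => m ⊗ₜ n) (fun m m' => add_tmul m m' n)

end TensorProduct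

/-- The map inducing the isomorphism of `HS₁(A)` with `ZMod 2 × ZMod 2`. -/
noncomputable def detect : A ⊗[ℤ] (A ⊗[ℤ] A) →+ ZMod 2 × ZMod 2 :=
  (tensorMul constCoeff (tensorMul tCoeff tCoeff) +
    tensorMul tCoeff (tensorMul constCoeff tCoeff) +
    tensorMul tCoeff (tensorMul tCoeff constCoeff)).prod
      (tensorMul tCoeff (tensorMul tCoeff tCoeff))

lemma detect_tmul (a b c : A) : detect (a ⊗ₜ (b ⊗ₜ c)) =
    (constCoeff a * (tCoeff b * tCoeff c) + tCoeff a * (constCoeff b * tCoeff c) +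
      tCoeff a * (tCoeff b * constCoeff c), tCoeff a * (tCoeff b * tCoeff c)) := rfl

lemma detect_surjective : Function.Surjective detect := by
  rintro ⟨x, y⟩
  refine ⟨x.val • ((1 : A) ⊗ₜ (t ⊗ₜ t)) + y.val • (t ⊗ₜ (t ⊗ₜ t)), ?_⟩
  rw [map_add, map_nsmul, map_nsmul]
  simp [detect_tmul]

/-- An additive map on `A ⊗ A ⊗ A` vanishes on the boundaries of the complex. -/
structure KillsBoundaries {G : Type*} [AddCommGroup G] (q : A ⊗[ℤ] (A ⊗[ℤ] A) →+ G) : Prop where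
  map_fst (a b c d : A) : q ((a * b) ⊗ₜ[ℤ] (c ⊗ₜ[ℤ] d) + d ⊗ₜ[ℤ] ((c * a) ⊗ₜ[ℤ] b) +
    (b * c * a) ⊗ₜ[ℤ] ((1 : A) ⊗ₜ[ℤ] d) + d ⊗ₜ[ℤ] ((b * c) ⊗ₜ[ℤ] a)) = 0
  map_snd (a : A) : q ((1 : A) ⊗ₜ[ℤ] (a ⊗ₜ[ℤ] (1 : A))) = 0

lemma killsBoundaries_detect : KillsBoundaries detect where
  map_fst a b c d := by
    simp only [map_add, detect_tmul, constCoeff_mul, tCoeff_mul, constCoeff_one, tCoeff_one]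
    ext
    · simp only [Prod.fst_add, Prod.fst_zero]
      ring_nf
      reduce_mod_char
    · simp only [Prod.snd_add, Prod.snd_zero]
      ring_nf
      reduce_mod_char
  map_snd a := by simp [detect_tmul]

namespace KillsBoundaries

variable {G : Type*} [AddCommGroup G] {q : A ⊗[ℤ] (A ⊗[ℤ] A) →+ G}

lemma prod {H : Type*} [AddCommGroup H] {r : A ⊗[ℤ] (A ⊗[ℤ] A) →+ H}
    (hq : KillsBoundaries q) (hr : KillsBoundaries r) : KillsBoundaries (q.prod r) where
  map_fst a b c d := Prod.ext (hq.map_fst a b c d) (hr.map_fst a b c d)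
  map_snd a := Prod.ext (hq.map_snd a) (hr.map_snd a)

lemma exists_map_tmul_eq (hq : KillsBoundaries q) (a b c : A) :
    ∃ m n : ℤ, q (a ⊗ₜ (b ⊗ₜ c)) = m • q (1 ⊗ₜ (t ⊗ₜ t)) + n • q (t ⊗ₜ (t ⊗ₜ t)) := by
  have r₃ := hq.map_snd
  have r₂ := hq.map_fst
  simp only [map_add] at r₂
  have e₁ := r₂ 1 1 t 1
  have e₂ := r₂ t 1 1 1
  have e₃ := r₂ t 1 t 1
  have e₄ := r₂ 1 1 t t
  simp only [mul_one, one_mul, t_mul_t, zero_tmul, tmul_zero, map_zero, r₃, add_zero,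
    zero_add] at e₁ e₂ e₃ e₄
  have e₅ : q (1 ⊗ₜ (1 ⊗ₜ t)) = 0 := by simpa [e₁] using e₂
  obtain ⟨a₀, a₁, rfl⟩ := exists_eq_add_smul_t a
  obtain ⟨b₀, b₁, rfl⟩ := exists_eq_add_smul_t b
  obtain ⟨c₀, c₁, rfl⟩ := exists_eq_add_smul_t c
  refine ⟨a₀ * b₁ * c₁ - a₁ * b₁ * c₀ + a₁ * b₀ * c₁, a₁ * b₁ * c₁, ?_⟩
  have left (k : ℤ) (x y z : A) : q ((k • x) ⊗ₜ (y ⊗ₜ z)) = k • q (x ⊗ₜ (y ⊗ₜ z)) :=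
    map_zsmul (q.comp (tmulRight A (y ⊗ₜ z))) k x
  have mid (k : ℤ) (x y z : A) : q (x ⊗ₜ ((k • y) ⊗ₜ z)) = k • q (x ⊗ₜ (y ⊗ₜ z)) :=
    map_zsmul ((q.comp (tmulLeft _ x)).comp (tmulRight A z)) k y
  have right (k : ℤ) (x y z : A) : q (x ⊗ₜ (y ⊗ₜ (k • z))) = k • q (x ⊗ₜ (y ⊗ₜ z)) :=
    map_zsmul ((q.comp (tmulLeft _ x)).comp (tmulLeft A y)) k z
  simp only [add_tmul, tmul_add, map_add, left, mid, right, r₃, e₁, e₅,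
    smul_zero, add_zero, zero_add]
  have e₆ := eq_neg_of_add_eq_zero_left e₃
  have e₇ : q (t ⊗ₜ (1 ⊗ₜ t)) = q (1 ⊗ₜ (t ⊗ₜ t)) := by
    rw [e₆] at e₄
    rw [← sub_eq_zero, ← e₄]
    abel
  rw [e₆, e₇]
  module

lemma exists_map_eq (hq : KillsBoundaries q) (x : A ⊗[ℤ] (A ⊗[ℤ] A)) :
    ∃ m n : ℤ, q x = m • q (1 ⊗ₜ (t ⊗ₜ t)) + n • q (t ⊗ₜ (t ⊗ₜ t)) := by
  have combine {x y} (hx : ∃ m n : ℤ, q x = m • q (1 ⊗ₜ (t ⊗ₜ t)) + n • q (t ⊗ₜ (t ⊗ₜ t)))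
      (hy : ∃ m n : ℤ, q y = m • q (1 ⊗ₜ (t ⊗ₜ t)) + n • q (t ⊗ₜ (t ⊗ₜ t))) :
      ∃ m n : ℤ, q (x + y) = m • q (1 ⊗ₜ (t ⊗ₜ t)) + n • q (t ⊗ₜ (t ⊗ₜ t)) := by
    obtain ⟨m, n, hx⟩ := hx
    obtain ⟨m', n', hy⟩ := hy
    exact ⟨m + m', n + n', by rw [map_add, hx, hy]; module⟩
  induction x with
  | zero => exact ⟨0, 0, by simp⟩
  | add x y hx hy => exact combine hx hy
  | tmul a y =>
    induction y with
    | zero => exact ⟨0, 0, by simp⟩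
    | add x y hx hy => rw [tmul_add]; exact combine hx hy
    | tmul b c => exact hq.exists_map_tmul_eq a b c

lemma two_zsmul_eq_zero (hq : KillsBoundaries q) (a : A) : (2 : ℤ) • q (a ⊗ₜ (t ⊗ₜ t)) = 0 := by
  simpa [t_mul_t, two_smul] using hq.map_fst t t 1 a

lemma map_eq_zero (hq : KillsBoundaries q) {x : A ⊗[ℤ] (A ⊗[ℤ] A)} (hx : detect x = 0) :
    q x = 0 := by
  obtain ⟨m, n, h⟩ := (hq.prod killsBoundaries_detect).exists_map_eq x
  have hq' : q x = m • q (1 ⊗ₜ (t ⊗ₜ t)) + n • q (t ⊗ₜ (t ⊗ₜ t)) := congrArg Prod.fst h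
  have hd : detect x = m • detect (1 ⊗ₜ (t ⊗ₜ t)) + n • detect (t ⊗ₜ (t ⊗ₜ t)) :=
    congrArg Prod.snd h
  rw [hx, eq_comm] at hd
  simp only [detect_tmul, constCoeff_one, tCoeff_one, constCoeff_t, tCoeff_t, mul_one, mul_zero,
    add_zero, Prod.smul_mk, zsmul_eq_mul, Prod.mk_add_mk, zero_add, Prod.mk_eq_zero] at hd
  obtain ⟨m, rfl⟩ := (ZMod.intCast_zmod_eq_zero_iff_dvd m 2).1 hd.1
  obtain ⟨n, rfl⟩ := (ZMod.intCast_zmod_eq_zero_iff_dvd n 2).1 hd.2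
  rw [hq']
  push_cast
  rw [mul_comm 2 m, mul_comm 2 n, mul_smul, mul_smul, hq.two_zsmul_eq_zero, hq.two_zsmul_eq_zero]
  simp

end KillsBoundaries

lemma eq_zero_of_tmul {M N G : Type*} [AddCommGroup M] [AddCommGroup N] [Module ℤ M] [Module ℤ N]
    [AddCommGroup G] {f : M ⊗[ℤ] N →+ G} (h : ∀ m n, f (m ⊗ₜ n) = 0) (x : M ⊗[ℤ] N) :
    f x = 0 := by
  induction x with
  | zero => exact map_zero f
  | add x y hx hy => rw [map_add, hx, hy, add_zero]
  | tmul m n => exact h m n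

lemma eq_zero_of_tmul_tmul {M N P G : Type*} [AddCommGroup M] [AddCommGroup N] [AddCommGroup P]
    [Module ℤ M] [Module ℤ N] [Module ℤ P] [AddCommGroup G] {f : M ⊗[ℤ] (N ⊗[ℤ] P) →+ G}
    (h : ∀ m n p, f (m ⊗ₜ (n ⊗ₜ p)) = 0) (x : M ⊗[ℤ] (N ⊗[ℤ] P)) : f x = 0 :=
  eq_zero_of_tmul (fun m y => eq_zero_of_tmul (f := f.comp (tmulLeft _ m)) (h m) y) x

lemma mem_range_iff
    (d₂ : ((A ⊗[ℤ] (A ⊗[ℤ] (A ⊗[ℤ] A))) × A) →ₗ[ℤ] A ⊗[ℤ] (A ⊗[ℤ] A))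
    (h₂ : ∀ a b c d : A, d₂ (a ⊗ₜ[ℤ] (b ⊗ₜ[ℤ] (c ⊗ₜ[ℤ] d)), 0) =
      (a * b) ⊗ₜ[ℤ] (c ⊗ₜ[ℤ] d) + d ⊗ₜ[ℤ] ((c * a) ⊗ₜ[ℤ] b) +
        (b * c * a) ⊗ₜ[ℤ] ((1 : A) ⊗ₜ[ℤ] d) + d ⊗ₜ[ℤ] ((b * c) ⊗ₜ[ℤ] a))
    (h₃ : ∀ a : A, d₂ (0, a) = (1 : A) ⊗ₜ[ℤ] (a ⊗ₜ[ℤ] (1 : A)))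
    (x : A ⊗[ℤ] (A ⊗[ℤ] A)) : x ∈ LinearMap.range d₂ ↔ detect x = 0 := by
  constructor
  · rintro ⟨⟨y, a⟩, rfl⟩
    have hy : (detect.comp d₂.toAddMonoidHom).comp (AddMonoidHom.inl _ _) y = 0 :=
      eq_zero_of_tmul (fun a z => eq_zero_of_tmul_tmul
        (f := ((detect.comp d₂.toAddMonoidHom).comp (AddMonoidHom.inl _ _)).comp (tmulLeft _ a))
        (fun b c d => (congrArg detect (h₂ a b c d)).trans
          (killsBoundaries_detect.map_fst a b c d)) z) y
    have ha : detect (d₂ (0, a)) = 0 := by rw [h₃, killsBoundaries_detect.map_snd]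
    rw [show (y, a) = (y, 0) + (0, a) by simp, map_add, map_add, ha, add_zero]
    exact hy
  · intro hx
    have hq : KillsBoundaries (LinearMap.range d₂).mkQ.toAddMonoidHom :=
      ⟨fun a b c d => (Submodule.Quotient.mk_eq_zero _).2 ⟨_, h₂ a b c d⟩,
        fun a => (Submodule.Quotient.mk_eq_zero _).2 ⟨_, h₃ a⟩⟩
    exact (Submodule.Quotient.mk_eq_zero _).1 (hq.map_eq_zero hx)

end HS1

/-- HS₁(ℤ[t]/(t²)) ≅ ℤ/2ℤ ⊕ ℤ/2ℤ: the first homology `ker ∂₁ / im ∂₂` of the partial complex is isomorphic as an abelian group to `ℤ/2ℤ ⊕ ℤ/2ℤ`. -/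
theorem HS1_int_t_sq
    (d₁ : A ⊗[ℤ] (A ⊗[ℤ] A) →ₗ[ℤ] A)
    (d₂ : ((A ⊗[ℤ] (A ⊗[ℤ] (A ⊗[ℤ] A))) × A) →ₗ[ℤ] A ⊗[ℤ] (A ⊗[ℤ] A))
    (h₁ : ∀ a b c : A, d₁ (a ⊗ₜ[ℤ] (b ⊗ₜ[ℤ] c)) = a * b * c - c * b * a)
    (h₂ : ∀ a b c d : A, d₂ (a ⊗ₜ[ℤ] (b ⊗ₜ[ℤ] (c ⊗ₜ[ℤ] d)), 0) =
      (a * b) ⊗ₜ[ℤ] (c ⊗ₜ[ℤ] d) + d ⊗ₜ[ℤ] ((c * a) ⊗ₜ[ℤ] b) +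
        (b * c * a) ⊗ₜ[ℤ] ((1 : A) ⊗ₜ[ℤ] d) + d ⊗ₜ[ℤ] ((b * c) ⊗ₜ[ℤ] a))
    (h₃ : ∀ a : A, d₂ (0, a) = (1 : A) ⊗ₜ[ℤ] (a ⊗ₜ[ℤ] (1 : A))) :
    Nonempty
      ((↥(LinearMap.ker d₁) ⧸
          Submodule.comap (LinearMap.ker d₁).subtype (LinearMap.range d₂)) ≃+
        (ZMod 2 × ZMod 2)) := by
  have hd₁ (x) : d₁ x = 0 :=
    HS1.eq_zero_of_tmul_tmul (f := d₁.toAddMonoidHom)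
      (fun a b c => (h₁ a b c).trans (by ring)) x
  let f : LinearMap.ker d₁ →ₗ[ℤ] ZMod 2 × ZMod 2 :=
    { toFun := fun x => HS1.detect x
      map_add' := fun x y => map_add HS1.detect _ _
      map_smul' := fun k x => map_intCast_smul HS1.detect ℤ ℤ k x.1 }
  have hf : Function.Surjective f := fun z =>
    (HS1.detect_surjective z).imp' (fun x => ⟨x, hd₁ x⟩) fun _ hx => hx
  have hker : Submodule.comap (LinearMap.ker d₁).subtype (LinearMap.range d₂) = LinearMap.ker f :=
    Submodule.ext fun x => HS1.mem_range_iff d₂ h₂ h₃ x.1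
  rw [hker]
  exact ⟨(f.quotKerEquivOfSurjective hf).toAddEquiv⟩
end
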